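/- Let 1 < p < ∞, N ≥ 2 and 0 < r0 < r1. For every c ∈ ℝ^N with 0 < |c| < r1 − r0, the p-torsional rigidity satisfies E(B(0,r1) \ closure(B(0,r0))) < E(B(0,r1) \ closure(B(c,r0))). In other words, among all placements of a ball of radius r0 whose closure lies inside B(0,r1), the p-torsional rigidity of the resulting annular region attains its minimum exactly in the concentric configuration. -/

import Mathlib

open MeasureTheory RealInnerProductSpace Metric Set

noncomputable section

/-- Smooth test functions compactly supported in `U` (the class `C_c^∞(U)`). -/
def IsTestFun {N : ℕ} (U : Set (EuclideanSpace ℝ (Fin N)))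
    (φ : EuclideanSpace ℝ (Fin N) → ℝ) : Prop :=
  ContDiff ℝ (⊤ : ℕ∞) φ ∧ HasCompactSupport φ ∧ tsupport φ ⊆ U

/-- `u` is a weak solution of `-Δ_p u = h` in `U`:
`∫_U |∇u|^{p-2} ⟨∇u, ∇φ⟩ = ∫_U h φ` for all test functions `φ`. -/
def IsWeakSolution (p : ℝ) {N : ℕ} (U : Set (EuclideanSpace ℝ (Fin N)))
    (u h : EuclideanSpace ℝ (Fin N) → ℝ) : Prop :=
  ∀ φ : EuclideanSpace ℝ (Fin N) → ℝ, IsTestFun U φ →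
    (∫ x in U, ‖gradient u x‖ ^ (p - 2) * ⟪gradient u x, gradient φ x⟫)
      = ∫ x in U, h x * φ x

/-- The `p`-torsional rigidity of `U`:
`E(U) = (p/(p-1)) ⬝ sup { ∫_U φ - (1/p) ∫_U |∇φ|^p : φ ∈ C_c^∞(U) }`. -/
def pTorsionalRigidity (p : ℝ) {N : ℕ} (U : Set (EuclideanSpace ℝ (Fin N))) : ℝ :=
  (p / (p - 1)) *
    sSup { r : ℝ | ∃ φ, IsTestFun U φ ∧
      r = (∫ x in U, φ x) - (1 / p) * ∫ x in U, ‖gradient φ x‖ ^ p }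

/-- The first Dirichlet eigenvalue of the `p`-Laplacian on `U`:
`λ₁(U) = inf { (∫_U |∇φ|^p)/(∫_U |φ|^p) : φ ∈ C_c^∞(U), φ ≢ 0 }`. -/
def pLambda1 (p : ℝ) {N : ℕ} (U : Set (EuclideanSpace ℝ (Fin N))) : ℝ :=
  sInf { r : ℝ | ∃ φ, IsTestFun U φ ∧ φ ≠ 0 ∧
    r = (∫ x in U, ‖gradient φ x‖ ^ p) / (∫ x in U, |φ x| ^ p) }

/-- `f` is `C^1` on the closure of `U` (i.e. `C^1` on an open neighbourhood of it). -/
def C1OnClosure {N : ℕ} (U : Set (EuclideanSpace ℝ (Fin N)))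
    (f : EuclideanSpace ℝ (Fin N) → ℝ) : Prop :=
  ∃ W, IsOpen W ∧ closure U ⊆ W ∧ ContDiffOn ℝ 1 f W

/-- `Ω` has a smooth boundary: it is the sublevel set of a smooth function whose
differential does not vanish on the boundary. -/
def HasSmoothBoundary {N : ℕ} (Ω : Set (EuclideanSpace ℝ (Fin N))) : Prop :=
  ∃ f : EuclideanSpace ℝ (Fin N) → ℝ, ContDiff ℝ (⊤ : ℕ∞) f ∧ Ω = f ⁻¹' Set.Iio 0 ∧
    ∀ x ∈ frontier Ω, fderiv ℝ f x ≠ 0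

/-- The index of the first coordinate. -/
def firstIdx (N : ℕ) (hN : 2 ≤ N) : Fin N := ⟨0, by omega⟩

/-- The first standard basis vector `e₁`. -/
def e1v {N : ℕ} (hN : 2 ≤ N) : EuclideanSpace ℝ (Fin N) :=
  EuclideanSpace.single (firstIdx N hN) 1

/-- The domain `Ω(s) = B(0,r1) \ closure B(s e₁, r0)`. -/
def annulus {N : ℕ} (hN : 2 ≤ N) (r0 r1 s : ℝ) : Set (EuclideanSpace ℝ (Fin N)) :=
  Metric.ball (0 : EuclideanSpace ℝ (Fin N)) r1 \ closure (Metric.ball (s • e1v hN) r0)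

/-- Reflection across the hyperplane `{x₁ = s}`: `x ↦ (2s - x₁, x₂, …, x_N)`. -/
def reflectH {N : ℕ} (hN : 2 ≤ N) (s : ℝ) (x : EuclideanSpace ℝ (Fin N)) :
    EuclideanSpace ℝ (Fin N) :=
  x + (2 * (s - x (firstIdx N hN))) • e1v hN

/-- The divergence of a vector field, as the trace of its Jacobian. -/
def divergence {N : ℕ} (V : EuclideanSpace ℝ (Fin N) → EuclideanSpace ℝ (Fin N))
    (x : EuclideanSpace ℝ (Fin N)) : ℝ :=
  LinearMap.trace ℝ _ (fderiv ℝ V x : EuclideanSpace ℝ (Fin N) →ₗ[ℝ] EuclideanSpace ℝ (Fin N))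

/-- The classical `p`-Laplacian `Δ_p b = div(|∇b|^{p-2} ∇b)` at a point. -/
def pLapAt (p : ℝ) {N : ℕ} (b : EuclideanSpace ℝ (Fin N) → ℝ)
    (x : EuclideanSpace ℝ (Fin N)) : ℝ :=
  divergence (fun z => ‖gradient b z‖ ^ (p - 2) • gradient b z) x

/-- The torsion function of `U`: `C^1` up to the boundary, vanishing on the boundary,
positive inside, weak solution of `-Δ_p y = 1`. -/
def IsTorsionFn (p : ℝ) {N : ℕ} (U : Set (EuclideanSpace ℝ (Fin N)))
    (y : EuclideanSpace ℝ (Fin N) → ℝ) : Prop :=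
  C1OnClosure U y ∧ (∀ x ∈ frontier U, y x = 0) ∧ (∀ x ∈ U, 0 < y x) ∧
    IsWeakSolution p U y (fun _ => 1)

/-- A first eigenfunction of the Dirichlet `p`-Laplacian on `U`: `C^1` up to the boundary,
positive inside, vanishing on the boundary, `L^p`-normalized, weak solution of
`-Δ_p u = λ₁(U) u^{p-1}`. -/
def IsFirstEigenfun (p : ℝ) {N : ℕ} (U : Set (EuclideanSpace ℝ (Fin N)))
    (y : EuclideanSpace ℝ (Fin N) → ℝ) : Prop :=
  C1OnClosure U y ∧ (∀ x ∈ U, 0 < y x) ∧ (∀ x ∈ frontier U, y x = 0) ∧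
    (∫ x in U, y x ^ p) = 1 ∧
    IsWeakSolution p U y (fun x => pLambda1 p U * y x ^ (p - 1))

/-- The matrix `DA(x) = |x|^{p-2} I + (p-2)|x|^{p-4} x xᵀ`,
the derivative of `A(x) = |x|^{p-2} x`. -/
def DA (p : ℝ) {N : ℕ} (x : EuclideanSpace ℝ (Fin N)) :
    EuclideanSpace ℝ (Fin N) →L[ℝ] EuclideanSpace ℝ (Fin N) :=
  ‖x‖ ^ (p - 2) • ContinuousLinearMap.id ℝ (EuclideanSpace ℝ (Fin N)) +
    ((p - 2) * ‖x‖ ^ (p - 4)) • (innerSL ℝ x).smulRight x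

/-- `w` is a nonnegative bounded weak solution, continuous on the closure of `Ω` and `C^1`
inside, of `-Δ_p w = F(x, w)` in `Ω` with boundary value `bdry` on `∂Ω`. -/
def SolClass (p : ℝ) {N : ℕ} (Ω : Set (EuclideanSpace ℝ (Fin N)))
    (F : EuclideanSpace ℝ (Fin N) → ℝ → ℝ)
    (bdry w : EuclideanSpace ℝ (Fin N) → ℝ) : Prop :=
  ContinuousOn w (closure Ω) ∧ ContDiffOn ℝ 1 w Ω ∧
    (∀ x ∈ closure Ω, 0 ≤ w x) ∧ (∃ M, ∀ x ∈ closure Ω, |w x| ≤ M) ∧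
    IsWeakSolution p Ω w (fun x => F x (w x)) ∧ (∀ x ∈ frontier Ω, w x = bdry x)

lemma norm_gradient_eq_norm_fderiv {E : Type*} [NormedAddCommGroup E] [InnerProductSpace ℝ E]
    [CompleteSpace E] (φ : E → ℝ) (x : E) :
    ‖gradient φ x‖ = ‖fderiv ℝ φ x‖ := by
  simp [gradient]

section General

variable {E : Type*} [NormedAddCommGroup E] [InnerProductSpace ℝ E] [FiniteDimensional ℝ E]
  [MeasurableSpace E] [BorelSpace E]

/-- Euler's identity, integrated against Lebesgue measure. -/
lemma integral_fderiv_apply_self {ψ : E → ℝ} (hψ : ContDiff ℝ 1 ψ) (hc : HasCompactSupport ψ) :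
    ∫ x, fderiv ℝ ψ x x = -(Module.finrank ℝ E * ∫ x, ψ x) := by
  set b := stdOrthonormalBasis ℝ E
  have hd : Continuous (fderiv ℝ ψ) := hψ.continuous_fderiv one_ne_zero
  have hcd : ∀ i, HasCompactSupport fun x => fderiv ℝ ψ x (b i) := fun i => hc.fderiv_apply ℝ (b i)
  have hexp : ∀ x, fderiv ℝ ψ x x = ∑ i, ⟪b i, x⟫ * fderiv ℝ ψ x (b i) := by
    intro x
    calc fderiv ℝ ψ x x = fderiv ℝ ψ x (∑ i, ⟪b i, x⟫ • b i) := by rw [b.sum_repr' x]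
      _ = _ := by simp only [map_sum, map_smul, smul_eq_mul]
  have hint : ∀ i, Integrable fun x => ⟪b i, x⟫ * fderiv ℝ ψ x (b i) := fun i =>
    Continuous.integrable_of_hasCompactSupport (by fun_prop) (hcd i).mul_left
  have hf : ∀ i (x : E), fderiv ℝ (fun y => ⟪b i, y⟫) x (b i) = 1 := by
    intro i x
    have h : HasFDerivAt (fun y : E => ⟪b i, y⟫) (innerSL ℝ (b i)) x :=
      (innerSL ℝ (b i)).hasFDerivAt
    rw [h.fderiv]
    simp [b.norm_eq_one]
  have hibp : ∀ i, ∫ x, ⟪b i, x⟫ * fderiv ℝ ψ x (b i) = -∫ x, ψ x := by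
    intro i
    rw [integral_mul_fderiv_eq_neg_fderiv_mul_of_integrable (μ := volume)]
    · simp [hf]
    · simpa [hf] using hψ.continuous.integrable_of_hasCompactSupport hc
    · exact hint i
    · exact Continuous.integrable_of_hasCompactSupport (by fun_prop) hc.mul_left
    · intro x _
      exact (innerSL ℝ (b i)).differentiableAt
    · intro x _
      exact hψ.differentiable one_ne_zero x
  simp_rw [hexp]
  rw [integral_finsetSum _ fun i _ => hint i]
  simp [hibp]

/-- If `k x • x` has divergence `-1` near the support of `φ`, then `∫ φ = ∫ k x * ⟨∇φ x, x⟩`. -/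
lemma integral_eq_integral_mul_fderiv_apply_self {φ k : E → ℝ} (hφ : ContDiff ℝ 1 φ)
    (hc : HasCompactSupport φ) (hk : ∀ x ∈ tsupport φ, ContDiffAt ℝ 1 k x)
    (hdiv : ∀ x ∈ tsupport φ, Module.finrank ℝ E * k x + fderiv ℝ k x x = -1) :
    Integrable (fun x => k x * fderiv ℝ φ x x) ∧
      ∫ x, φ x = ∫ x, k x * fderiv ℝ φ x x := by
  have hψ : ContDiff ℝ 1 fun x => k x * φ x := by
    rw [contDiff_iff_contDiffAt]
    intro x
    by_cases hx : x ∈ tsupport φ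
    · exact (hk x hx).mul hφ.contDiffAt
    · refine contDiffAt_const (c := (0 : ℝ)) |>.congr_of_eventuallyEq ?_
      filter_upwards [notMem_tsupport_iff_eventuallyEq.1 hx] with y hy
      simp [hy]
  have hψc : HasCompactSupport fun x => k x * φ x := hc.mul_left
  have hpt : ∀ x, k x * fderiv ℝ φ x x = fderiv ℝ (fun x => k x * φ x) x x
      + Module.finrank ℝ E * (k x * φ x) + φ x := by
    intro x
    by_cases hx : x ∈ tsupport φ
    · have h := fderiv_fun_mul ((hk x hx).differentiableAt one_ne_zero)
        (hφ.differentiable one_ne_zero x)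
      rw [h]
      simp only [add_apply, FunLike.coe_smul, Pi.smul_apply, smul_eq_mul]
      linear_combination (-φ x) * hdiv x hx
    · have h0 := notMem_tsupport_iff_eventuallyEq.1 hx
      have h1 : (fun x => k x * φ x) =ᶠ[nhds x] fun _ => 0 := by
        filter_upwards [h0] with y hy
        simp [hy]
      rw [h0.fderiv_eq, h1.fderiv_eq, h0.eq_of_nhds]
      simp
  have hdc : Continuous fun x => fderiv ℝ (fun x => k x * φ x) x x :=
    (hψ.continuous_fderiv one_ne_zero).clm_apply continuous_id
  have hi1 : Integrable fun x => fderiv ℝ (fun x => k x * φ x) x x := by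
    refine hdc.integrable_of_hasCompactSupport ((hψc.fderiv ℝ).mono' ?_)
    intro x hx
    refine subset_tsupport _ ?_
    contrapose! hx
    simp only [Function.mem_support, ne_eq, not_not] at hx ⊢
    rw [hx]; rfl
  have hi2 : Integrable fun x => Module.finrank ℝ E * (k x * φ x) :=
    (hψ.continuous.integrable_of_hasCompactSupport hψc).const_mul _
  have hi3 : Integrable φ := hφ.continuous.integrable_of_hasCompactSupport hc
  simp_rw [hpt]
  refine ⟨(hi1.add hi2).add hi3, ?_⟩
  have h := integral_add (hi1.add hi2) hi3
  simp only [Pi.add_apply] at h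
  rw [h, integral_add hi1 hi2, integral_fderiv_apply_self hψ hψc, integral_const_mul]
  ring

lemma integrable_norm_fderiv_rpow {φ : E → ℝ} {p : ℝ} (hp : 0 < p) (hφ : ContDiff ℝ 1 φ)
    (hc : HasCompactSupport φ) : Integrable fun x => ‖fderiv ℝ φ x‖ ^ p := by
  refine Continuous.integrable_of_hasCompactSupport
    ((hφ.continuous_fderiv one_ne_zero).norm.rpow_const fun _ => Or.inr hp.le)
    ((hc.fderiv ℝ).mono ?_)
  intro x hx
  contrapose! hx
  simp only [Function.mem_support, ne_eq, not_not] at hx ⊢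
  simp [hx, hp.ne']

/-- Thompson's principle: a vector field `k x • x` of divergence `-1` bounds the torsion energy
from above. -/
lemma integral_sub_le_of_divergence_eq {U : Set E} (hU : MeasurableSet U) {p q : ℝ}
    (hpq : p.HolderConjugate q) {φ k : E → ℝ} {H : E → ℝ} (hφ : ContDiff ℝ 1 φ)
    (hc : HasCompactSupport φ) (hφU : tsupport φ ⊆ U) (hk : ∀ x ∈ U, ContDiffAt ℝ 1 k x)
    (hdiv : ∀ x ∈ U, Module.finrank ℝ E * k x + fderiv ℝ k x x = -1)
    (hH : ∀ x ∈ U, |k x| * ‖x‖ ≤ H x) (hHi : IntegrableOn (fun x => H x ^ q) U) :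
    (∫ x in U, φ x) - (1 / p) * ∫ x in U, ‖fderiv ℝ φ x‖ ^ p ≤ (1 / q) * ∫ x in U, H x ^ q := by
  obtain ⟨hi, heq⟩ := integral_eq_integral_mul_fderiv_apply_self hφ hc
    (fun x hx => hk x (hφU hx)) (fun x hx => hdiv x (hφU hx))
  have h1 : ∫ x in U, φ x = ∫ x, φ x :=
    setIntegral_eq_integral_of_forall_compl_eq_zero fun x hx =>
      image_eq_zero_of_notMem_tsupport fun h => hx (hφU h)
  have h2 : ∫ x in U, k x * fderiv ℝ φ x x = ∫ x, k x * fderiv ℝ φ x x := by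
    refine setIntegral_eq_integral_of_forall_compl_eq_zero fun x hx => ?_
    rw [(notMem_tsupport_iff_eventuallyEq.1 fun h => hx (hφU h)).fderiv_eq]
    simp
  have hgi : IntegrableOn (fun x => ‖fderiv ℝ φ x‖ ^ p) U :=
    (integrable_norm_fderiv_rpow hpq.pos hφ hc).integrableOn
  have h3 : ∫ x in U, k x * fderiv ℝ φ x x ≤
      ∫ x in U, ((1 / p) * ‖fderiv ℝ φ x‖ ^ p + (1 / q) * H x ^ q) := by
    refine setIntegral_mono_on hi.integrableOn ((hgi.const_mul _).add (hHi.const_mul _)) hU ?_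
    intro x hx
    have hH0 : 0 ≤ H x := le_trans (by positivity) (hH x hx)
    calc k x * fderiv ℝ φ x x ≤ |k x| * (‖fderiv ℝ φ x‖ * ‖x‖) := by
          refine (le_abs_self _).trans ?_
          rw [abs_mul]
          gcongr
          exact (fderiv ℝ φ x).le_opNorm x
      _ = ‖fderiv ℝ φ x‖ * (|k x| * ‖x‖) := by ring
      _ ≤ ‖fderiv ℝ φ x‖ * H x := by gcongr; exact hH x hx
      _ ≤ ‖fderiv ℝ φ x‖ ^ p / p + H x ^ q / q :=
          Real.young_inequality_of_nonneg (norm_nonneg _) hH0 hpq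
      _ = _ := by ring
  rw [integral_add (hgi.const_mul _) (hHi.const_mul _), integral_const_mul,
    integral_const_mul] at h3
  rw [h1, heq, ← h2]
  linarith

end General

section Mollification

variable {E : Type*} [NormedAddCommGroup E] [InnerProductSpace ℝ E] [FiniteDimensional ℝ E]
  [MeasurableSpace E] [BorelSpace E]

open scoped Convolution Topology
open Filter ContinuousLinearMap

lemma ContDiffBump.norm_normed_convolution_le {F : Type*} [NormedAddCommGroup F] [NormedSpace ℝ F]
    [CompleteSpace F] (φ : ContDiffBump (0 : E)) {g : E → F} (hg : Continuous g) {C : ℝ}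
    (hC : ∀ x, ‖g x‖ ≤ C) (x : E) :
    ‖(φ.normed volume ⋆[lsmul ℝ ℝ, volume] g : E → F) x‖ ≤ 3 * C := by
  have h := φ.dist_normed_convolution_le (μ := volume) (x₀ := x) (ε := 2 * C)
    hg.aestronglyMeasurable fun y _ => by
      rw [dist_eq_norm]
      refine (norm_sub_le _ _).trans ?_
      linarith [hC x, hC y]
  rw [dist_eq_norm] at h
  have := norm_le_norm_add_norm_sub' ((φ.normed volume ⋆[lsmul ℝ ℝ, volume] g : E → F) x) (g x)
  linarith [hC x]

lemma ContDiffBump.fderiv_normed_convolution (φ : ContDiffBump (0 : E)) {v : E → ℝ}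
    (hv : ContDiff ℝ 1 v) (hc : HasCompactSupport v) (x : E) :
    fderiv ℝ (φ.normed volume ⋆[lsmul ℝ ℝ, volume] v : E → ℝ) x =
      (φ.normed volume ⋆[lsmul ℝ ℝ, volume] fderiv ℝ v : E → E →L[ℝ] ℝ) x := by
  have hl : LocallyIntegrable (φ.normed volume) (volume : Measure E) :=
    φ.continuous_normed.locallyIntegrable
  rw [(hc.hasFDerivAt_convolution_right (lsmul ℝ ℝ) hl hv x).fderiv]
  rfl

lemma ContDiffBump.tsupport_normed_convolution_subset (φ : ContDiffBump (0 : E)) (v : E → ℝ) :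
    tsupport (φ.normed volume ⋆[lsmul ℝ ℝ, volume] v : E → ℝ) ⊆
      cthickening φ.rOut (tsupport v) := by
  refine closure_minimal ?_ isClosed_cthickening
  intro x hx
  obtain ⟨y, hy, z, hz, rfl⟩ := Set.mem_add.1 (support_convolution_subset (lsmul ℝ ℝ) hx)
  refine mem_cthickening_of_dist_le _ z _ _ (subset_tsupport _ hz) ?_
  rw [φ.support_normed_eq, mem_ball_zero_iff] at hy
  simpa using hy.le

/-- Functions of class `C^1` with compact support are admissible for the torsion energy. -/
lemma exists_contDiff_tendsto_energy {U : Set E} (hU : IsOpen U) (hUf : volume U ≠ ⊤) {p : ℝ}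
    (hp : 0 < p) {v : E → ℝ} (hv : ContDiff ℝ 1 v) (hc : HasCompactSupport v)
    (hvU : tsupport v ⊆ U) :
    ∃ φ : ℕ → E → ℝ, (∀ n, ContDiff ℝ (⊤ : ℕ∞) (φ n)) ∧ (∀ n, HasCompactSupport (φ n)) ∧
      (∀ n, tsupport (φ n) ⊆ U) ∧
      Tendsto (fun n => (∫ x in U, φ n x) - (1 / p) * ∫ x in U, ‖fderiv ℝ (φ n) x‖ ^ p) atTop
        (𝓝 ((∫ x in U, v x) - (1 / p) * ∫ x in U, ‖fderiv ℝ v x‖ ^ p)) := by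
  obtain ⟨δ, hδ, hδU⟩ := hc.isCompact.exists_cthickening_subset_open hU hvU
  set b : ℕ → ContDiffBump (0 : E) := fun n =>
    ⟨δ / (n + 2), δ / (n + 1), by positivity, by gcongr; linarith⟩
  have hb : Tendsto (fun n => (b n).rOut) atTop (𝓝 0) :=
    tendsto_const_div_atTop_nhds_zero_nat δ |>.comp (tendsto_add_atTop_nat 1) |>.congr fun n => by
      simp [b]
  have hbδ : ∀ n, (b n).rOut ≤ δ := fun n => div_le_self hδ.le (by
    have : (0 : ℝ) ≤ n := Nat.cast_nonneg n
    linarith)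
  have hts : ∀ n, tsupport ((b n).normed volume ⋆[lsmul ℝ ℝ, volume] v : E → ℝ) ⊆
      cthickening δ (tsupport v) := fun n =>
    ((b n).tsupport_normed_convolution_subset v).trans (cthickening_mono (hbδ n) _)
  have hd : Continuous (fderiv ℝ v) := hv.continuous_fderiv one_ne_zero
  obtain ⟨C, hC⟩ := hc.exists_bound_of_continuous hv.continuous
  obtain ⟨D, hD⟩ := (hc.fderiv ℝ).exists_bound_of_continuous hd
  have hsm : ∀ n, ContDiff ℝ (⊤ : ℕ∞)
      ((b n).normed volume ⋆[lsmul ℝ ℝ, volume] v : E → ℝ) := fun n =>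
    (b n).hasCompactSupport_normed.contDiff_convolution_left _ (b n).contDiff_normed
      hv.continuous.locallyIntegrable
  have : IsFiniteMeasure (volume.restrict U) := ⟨by simpa using hUf.lt_top⟩
  refine ⟨fun n => (b n).normed volume ⋆[lsmul ℝ ℝ, volume] v, hsm, fun n => ?_,
    fun n => (hts n).trans hδU, ?_⟩
  · exact hc.isCompact.cthickening.of_isClosed_subset (isClosed_tsupport _) (hts n)
  · refine Tendsto.sub ?_ (Tendsto.const_mul _ ?_)
    · refine tendsto_integral_of_dominated_convergence (fun _ => 3 * C) (fun n => ?_)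
        (integrable_const _) (fun n => ?_) ?_
      · exact (hsm n).continuous.aestronglyMeasurable
      · exact Eventually.of_forall ((b n).norm_normed_convolution_le hv.continuous hC)
      · exact Eventually.of_forall fun x =>
          ContDiffBump.convolution_tendsto_right_of_continuous hb hv.continuous x
    · refine tendsto_integral_of_dominated_convergence (fun _ => (3 * D) ^ p) (fun n => ?_)
        (integrable_const _) (fun n => ?_) ?_
      · exact (((hsm n).continuous_fderiv (by simp)).norm.rpow_const
          fun _ => Or.inr hp.le).aestronglyMeasurable
      · refine Eventually.of_forall fun x => ?_
        rw [(b n).fderiv_normed_convolution hv hc, Real.norm_of_nonneg (by positivity)]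
        exact Real.rpow_le_rpow (norm_nonneg _) ((b n).norm_normed_convolution_le hd hD x) hp.le
      · refine Eventually.of_forall fun x => ?_
        simp_rw [(b _).fderiv_normed_convolution hv hc]
        exact ((ContDiffBump.convolution_tendsto_right_of_continuous hb hd x).norm).rpow_const
          (Or.inr hp.le)

end Mollification

section Truncation

/-- A `C^1` approximation of the positive part. -/
lemma exists_smooth_posPart {ε : ℝ} (hε : 0 < ε) : ∃ χ χ' : ℝ → ℝ,
    (∀ t, HasDerivAt χ (χ' t) t) ∧ Continuous χ' ∧ (∀ t, 0 ≤ χ' t) ∧ (∀ t, χ' t ≤ 1) ∧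
      (∀ t ≤ 0, χ t = 0) ∧ (∀ t, χ t ≤ max t 0) ∧ ∀ t, t - ε ≤ χ t := by
  set χ' : ℝ → ℝ := fun s => min 1 (max 0 (s / ε)) with hχ'
  have hcont : Continuous χ' := by fun_prop
  have hd : ∀ t, HasDerivAt (fun t => ∫ s in (0 : ℝ)..t, χ' s) (χ' t) t := fun t =>
    intervalIntegral.integral_hasDerivAt_right (hcont.intervalIntegrable _ _)
      (hcont.stronglyMeasurableAtFilter _ _) hcont.continuousAt
  have h0 : ∀ t, 0 ≤ χ' t := fun t => le_min zero_le_one (le_max_left _ _)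
  have h1 : ∀ t, χ' t ≤ 1 := fun t => min_le_left _ _
  have hz : ∀ t ≤ 0, ∫ s in (0 : ℝ)..t, χ' s = 0 := by
    intro t ht
    rw [intervalIntegral.integral_congr (g := fun _ => 0)]
    · simp
    · intro s hs
      rw [uIcc_of_ge ht] at hs
      have : s / ε ≤ 0 := div_nonpos_of_nonpos_of_nonneg hs.2 hε.le
      simp [hχ', this]
  have hmono : Monotone fun t => ∫ s in (0 : ℝ)..t, χ' s :=
    monotone_of_deriv_nonneg (fun t => (hd t).differentiableAt) fun t => by
      rw [(hd t).deriv]; exact h0 t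
  have hnonneg : ∀ t, 0 ≤ ∫ s in (0 : ℝ)..t, χ' s := by
    intro t
    rcases le_total t 0 with ht | ht
    · rw [hz t ht]
    · simpa using hmono ht
  refine ⟨fun t => ∫ s in (0 : ℝ)..t, χ' s, χ', hd, hcont, h0, h1, hz, fun t => ?_, fun t => ?_⟩
  · rcases le_total t 0 with ht | ht
    · simp only [hz t ht]; exact le_max_right _ _
    · refine le_trans ?_ (le_max_left _ _)
      have := intervalIntegral.integral_mono_on ht (hcont.intervalIntegrable 0 t)
        (continuous_const.intervalIntegrable (μ := volume) (u := fun _ => (1 : ℝ)) 0 t)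
        fun s _ => h1 s
      simpa using this
  · rcases le_total t ε with ht | ht
    · linarith [hnonneg t]
    · have hadd := intervalIntegral.integral_add_adjacent_intervals
        (hcont.intervalIntegrable (μ := volume) 0 ε) (hcont.intervalIntegrable (μ := volume) ε t)
      have : ∫ s in ε..t, χ' s = t - ε := by
        rw [intervalIntegral.integral_congr (g := fun _ => 1)]
        · simp
        · intro s hs
          rw [uIcc_of_le ht] at hs
          have : 1 ≤ s / ε := (one_le_div hε).2 hs.1
          simp only [hχ']
          rw [min_eq_left (this.trans (le_max_right _ _))]
      show t - ε ≤ ∫ s in (0 : ℝ)..t, χ' s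
      linarith [hnonneg ε]

variable {E : Type*} [NormedAddCommGroup E] [InnerProductSpace ℝ E] [FiniteDimensional ℝ E]
  [MeasurableSpace E] [BorelSpace E]

/-- If the torsion energy of all compactly supported `C^1` functions is bounded by `S`, then so is
an energy of the positive part of `min f g`, where the Dirichlet energies of `f` and `g` are
added. -/
lemma integral_min_sub_le_of_forall_energy_le {U : Set E}
    (hUf : volume U ≠ ⊤) {p S : ℝ} (hp : 0 < p)
    (hS : ∀ v : E → ℝ, ContDiff ℝ 1 v → HasCompactSupport v → tsupport v ⊆ U →
      (∫ x in U, v x) - (1 / p) * ∫ x in U, ‖fderiv ℝ v x‖ ^ p ≤ S)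
    {f g A B : E → ℝ}
    (hfd : ∀ x, 0 < f x → 0 < g x → ContDiffAt ℝ 1 f x ∧ ContDiffAt ℝ 1 g x ∧
      ‖fderiv ℝ f x‖ ≤ A x ∧ ‖fderiv ℝ g x‖ ≤ B x)
    (hK : ∀ ε > 0, IsCompact {x | ε ≤ f x ∧ ε ≤ g x})
    (hpos : ∀ x, 0 < f x → 0 < g x → x ∈ U)
    (hA : ∀ x, 0 ≤ A x) (hB : ∀ x, 0 ≤ B x)
    (hi : IntegrableOn (fun x => min (f x) (g x)) U)
    (hAi : IntegrableOn (fun x => A x ^ p) U) (hBi : IntegrableOn (fun x => B x ^ p) U) :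
    (∫ x in U, min (f x) (g x)) - (1 / p) * ∫ x in U, (A x ^ p + B x ^ p) ≤ S := by
  have key : ∀ ε > 0, (∫ x in U, min (f x) (g x)) -
      (1 / p) * ∫ x in U, (A x ^ p + B x ^ p) ≤ S + volume.real U * (3 * ε) := by
    intro ε hε
    obtain ⟨χ, χ', hd, hc, h0, h1, hz, hle, hge⟩ := exists_smooth_posPart hε
    have hχ : ContDiff ℝ 1 χ := by
      rw [contDiff_one_iff_deriv]
      refine ⟨fun t => (hd t).differentiableAt, ?_⟩
      rwa [show deriv χ = χ' from funext fun t => (hd t).deriv]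
    set m : E → ℝ := fun x => f x - χ (f x - g x) - 2 * ε with hm
    set v : E → ℝ := fun x => χ (m x) with hv
    have hmle : ∀ x, m x ≤ min (f x) (g x) - ε := by
      intro x
      have := hge (f x - g x)
      have h2 : 0 ≤ χ (f x - g x) ∨ f x - g x ≤ 0 := by
        rcases le_total (f x - g x) 0 with h | h
        · exact Or.inr h
        · left
          have hmono : Monotone χ := monotone_of_deriv_nonneg
            (fun t => (hd t).differentiableAt) fun t => by rw [(hd t).deriv]; exact h0 t
          simpa [hz 0 le_rfl] using hmono h
      rw [min_def]
      split_ifs with h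
      · have := hz (f x - g x) (by linarith)
        simp only [hm]; linarith
      · simp only [hm]; linarith
    have hmge : ∀ x, min (f x) (g x) - 2 * ε ≤ m x := by
      intro x
      have := hle (f x - g x)
      simp only [hm]
      rcases le_total (f x) (g x) with h | h
      · rw [min_eq_left h]
        rw [max_eq_right (by linarith)] at this
        linarith
      · rw [min_eq_right h]
        rw [max_eq_left (by linarith)] at this
        linarith
    set K : Set E := {x | ε ≤ f x ∧ ε ≤ g x} with hKdef
    have hvK : ∀ x, x ∉ K → v x = 0 := by
      intro x hx
      refine hz _ ((hmle x).trans ?_)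
      rcases not_and_or.1 hx with h | h
      · linarith [min_le_left (f x) (g x)]
      · linarith [min_le_right (f x) (g x)]
    have hKc : IsClosed K := (hK ε hε).isClosed
    have hts : tsupport v ⊆ K := closure_minimal
      (fun x hx => by by_contra h; exact hx (hvK x h)) hKc
    have hev : ∀ x, x ∉ K → v =ᶠ[nhds x] fun _ => 0 := fun x hx => by
      filter_upwards [hKc.isOpen_compl.mem_nhds hx] with y hy using hvK y hy
    have hKpos : ∀ x ∈ K, 0 < f x ∧ 0 < g x := fun x hx =>
      ⟨hε.trans_le hx.1, hε.trans_le hx.2⟩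
    have hvC : ContDiff ℝ 1 v := by
      rw [contDiff_iff_contDiffAt]
      intro x
      by_cases hx : x ∈ K
      · obtain ⟨hfx, hgx, -, -⟩ := hfd x (hKpos x hx).1 (hKpos x hx).2
        exact hχ.contDiffAt.comp x
          ((hfx.sub (hχ.contDiffAt.comp x (hfx.sub hgx))).sub contDiffAt_const)
      · exact contDiffAt_const.congr_of_eventuallyEq (hev x hx)
    have hvc : HasCompactSupport v :=
      (hK ε hε).of_isClosed_subset (isClosed_tsupport _) hts
    have hvU : tsupport v ⊆ U := fun x hx =>
      hpos x (hKpos x (hts hx)).1 (hKpos x (hts hx)).2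
    have hgrad : ∀ x, ‖fderiv ℝ v x‖ ^ p ≤ A x ^ p + B x ^ p := by
      intro x
      have hAp := Real.rpow_nonneg (hA x) p
      have hBp := Real.rpow_nonneg (hB x) p
      by_cases hx : x ∈ K
      · obtain ⟨hfx, hgx, hfA, hgB⟩ := hfd x (hKpos x hx).1 (hKpos x hx).2
        have hfx' := (hfx.differentiableAt one_ne_zero).hasFDerivAt
        have hgx' := (hgx.differentiableAt one_ne_zero).hasFDerivAt
        have hvx : HasFDerivAt v (χ' (m x) • (fderiv ℝ f x -
            χ' (f x - g x) • (fderiv ℝ f x - fderiv ℝ g x))) x :=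
          (hd (m x)).comp_hasFDerivAt x
            ((hfx'.sub ((hd (f x - g x)).comp_hasFDerivAt x (hfx'.sub hgx'))).sub_const _)
        have hb : ‖fderiv ℝ v x‖ ≤ max (A x) (B x) := by
          rw [hvx.fderiv, norm_smul, Real.norm_of_nonneg (h0 _)]
          set l := χ' (f x - g x)
          have hl0 : 0 ≤ l := h0 _
          have hl1 : 0 ≤ 1 - l := sub_nonneg.2 (h1 _)
          have : fderiv ℝ f x - l • (fderiv ℝ f x - fderiv ℝ g x) =
              (1 - l) • fderiv ℝ f x + l • fderiv ℝ g x := by module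
          rw [this]
          calc χ' (m x) * ‖(1 - l) • fderiv ℝ f x + l • fderiv ℝ g x‖
              ≤ 1 * ‖(1 - l) • fderiv ℝ f x + l • fderiv ℝ g x‖ := by gcongr; exact h1 _
            _ ≤ (1 - l) * ‖fderiv ℝ f x‖ + l * ‖fderiv ℝ g x‖ := by
                rw [one_mul]
                refine (norm_add_le _ _).trans_eq ?_
                rw [norm_smul, norm_smul, Real.norm_of_nonneg hl0, Real.norm_of_nonneg hl1]
            _ ≤ (1 - l) * max (A x) (B x) + l * max (A x) (B x) := by
                gcongr
                · exact hfA.trans (le_max_left _ _)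
                · exact hgB.trans (le_max_right _ _)
            _ = max (A x) (B x) := by ring
        refine (Real.rpow_le_rpow (norm_nonneg _) hb hp.le).trans ?_
        rcases le_total (A x) (B x) with h | h
        · rw [max_eq_right h]; linarith
        · rw [max_eq_left h]; linarith
      · rw [(hev x hx).fderiv_eq]
        simp only [fderiv_fun_const, Pi.zero_apply, norm_zero, Real.zero_rpow hp.ne']
        positivity
    have hconst : IntegrableOn (fun _ : E => 3 * ε) U := integrableOn_const hUf
    have e1 : ∫ x in U, (min (f x) (g x) - 3 * ε) ≤ ∫ x in U, v x :=
      setIntegral_mono (hi.sub hconst)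
        (hvC.continuous.integrable_of_hasCompactSupport hvc).integrableOn fun x => by
          have := hge (m x)
          have := hmge x
          simp only [hv]; linarith
    have e2 : ∫ x in U, ‖fderiv ℝ v x‖ ^ p ≤ ∫ x in U, (A x ^ p + B x ^ p) :=
      setIntegral_mono (integrable_norm_fderiv_rpow hp hvC hvc).integrableOn (hAi.add hBi) hgrad
    rw [integral_sub hi hconst, setIntegral_const, smul_eq_mul] at e1
    have e3 := mul_le_mul_of_nonneg_left e2 (one_div_nonneg.2 hp.le)
    have := hS v hvC hvc hvU
    linarith
  refine le_of_forall_pos_le_add fun η hη => ?_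
  have hV : 0 ≤ volume.real U := measureReal_nonneg
  refine (key (η / (3 * (volume.real U + 1))) (by positivity)).trans ?_
  gcongr
  rw [show volume.real U * (3 * (η / (3 * (volume.real U + 1)))) =
    η * (volume.real U / (volume.real U + 1)) by field_simp]
  exact mul_le_of_le_one_right hη.le (div_le_one_of_le₀ (by linarith) (by linarith))

end Truncation

section Radial

/-- The slope of the radial solution where the flux is `t / (n s ^ (n - 1))`, made continuous
below radius `a`. -/
def radialSlope (n : ℕ) (e a t s : ℝ) : ℝ := (max t 0 / (n * max s a ^ (n - 1))) ^ e

lemma continuous_radialSlope {n : ℕ} (hn : n ≠ 0) {e a : ℝ} (he : 0 ≤ e) (ha : 0 < a)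
    {X : Type*} [TopologicalSpace X] {t s : X → ℝ} (ht : Continuous t) (hs : Continuous s) :
    Continuous fun x => radialSlope n e a (t x) (s x) := by
  refine Continuous.rpow_const (Continuous.div (by fun_prop) (by fun_prop) fun x => ?_)
    fun _ => Or.inr he
  have : 0 < max (s x) a := ha.trans_le (le_max_right _ _)
  positivity

lemma radialSlope_nonneg {n : ℕ} {e a : ℝ} (ha : 0 < a) (t s : ℝ) :
    0 ≤ radialSlope n e a t s := by
  have : 0 < max s a := ha.trans_le (le_max_right _ _)
  unfold radialSlope
  positivity

lemma radialSlope_of_nonpos {n : ℕ} {e a t : ℝ} (he : e ≠ 0) (ht : t ≤ 0) (s : ℝ) :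
    radialSlope n e a t s = 0 := by
  simp [radialSlope, max_eq_right ht, he]

lemma radialSlope_pos {n : ℕ} (hn : n ≠ 0) {e a t : ℝ} (ha : 0 < a) (ht : 0 < t) (s : ℝ) :
    0 < radialSlope n e a t s := by
  have : 0 < max s a := ha.trans_le (le_max_right _ _)
  have : 0 < max t 0 := lt_max_of_lt_left ht
  unfold radialSlope
  positivity

lemma mul_radialSlope {n : ℕ} (hn : n ≠ 0) {p q a t s : ℝ} (hpq : p.HolderConjugate q)
    (ha : 0 < a) (ht : 0 ≤ t) (hs : a ≤ s) :
    t / n * radialSlope n (1 / (p - 1)) a t s =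
        s ^ (n - 1) * radialSlope n (1 / (p - 1)) a t s ^ p ∧
      (t / (n * s ^ (n - 1))) ^ q = radialSlope n (1 / (p - 1)) a t s ^ p := by
  have hs0 : 0 < s := ha.trans_le hs
  have hp1 : 0 < p - 1 := sub_pos.2 hpq.lt
  have hq : q = p / (p - 1) := hpq.conjugate_eq
  set h := t / (n * s ^ (n - 1)) with hh
  have hh0 : 0 ≤ h := by positivity
  have hr : radialSlope n (1 / (p - 1)) a t s = h ^ (1 / (p - 1)) := by
    simp [radialSlope, max_eq_left ht, max_eq_left hs, hh]
  have hrp : radialSlope n (1 / (p - 1)) a t s ^ p = h ^ q := by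
    rw [hr, ← Real.rpow_mul hh0, hq]
    congr 1
    ring
  refine ⟨?_, hrp.symm⟩
  have hth : t / n = s ^ (n - 1) * h := by
    rw [hh]; field_simp
  have hq' : q = 1 + 1 / (p - 1) := by rw [hq]; field_simp; ring
  rw [hrp, hth, hr, mul_assoc, hq']
  rcases hh0.eq_or_lt with h0 | h0
  · rw [← h0]
    rw [Real.zero_rpow (by positivity : 1 + 1 / (p - 1) ≠ 0)]
    simp
  · rw [Real.rpow_add h0, Real.rpow_one]

/-- The increasing part `α` and the decreasing part `β` of the radial torsion function
`α + β - M` of the annulus `r0 < |x| < r1` in dimension `n`, whose maximum `M` is attained on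
the sphere of radius `ρ`. -/
structure IsRadialProfile (n : ℕ) (p q r0 r1 ρ M : ℝ) (α β α' β' : ℝ → ℝ) : Prop where
  lt_rho : r0 < ρ
  rho_lt : ρ < r1
  continuous_inner : Continuous α'
  continuous_outer : Continuous β'
  inner_nonneg : ∀ s, 0 ≤ α' s
  outer_nonneg : ∀ s, 0 ≤ β' s
  inner_eq_zero : ∀ s, ρ ≤ s → α' s = 0
  outer_eq_zero : ∀ s, 0 ≤ s → s ≤ ρ → β' s = 0
  inner_pos : ∀ s, 0 ≤ s → s < ρ → 0 < α' s
  outer_pos : ∀ s, ρ < s → 0 < β' s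
  hasDerivAt_inner : ∀ s, HasDerivAt α (α' s) s
  hasDerivAt_outer : ∀ s, HasDerivAt β (-β' s) s
  inner_left : α r0 = 0
  outer_right : β r1 = 0
  inner_rho : α ρ = M
  outer_rho : β ρ = M
  flux_mul : ∀ s, r0 ≤ s → (ρ ^ n - s ^ n) / n * (α' s - β' s) =
    s ^ (n - 1) * (α' s ^ p + β' s ^ p)
  flux_rpow : ∀ s, r0 ≤ s → (|ρ ^ n - s ^ n| / (n * s ^ (n - 1))) ^ q = α' s ^ p + β' s ^ p

lemma exists_isRadialProfile {n : ℕ} (hn : n ≠ 0) {p q r0 r1 : ℝ} (hpq : p.HolderConjugate q)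
    (hr0 : 0 < r0) (hr01 : r0 < r1) :
    ∃ ρ M α β α' β', IsRadialProfile n p q r0 r1 ρ M α β α' β' := by
  have hp1 : 0 < p - 1 := sub_pos.2 hpq.lt
  set e := 1 / (p - 1) with he
  have he0 : 0 < e := by positivity
  set A : ℝ → ℝ → ℝ := fun ρ s => radialSlope n e r0 (ρ ^ n - s ^ n) s with hA
  set B : ℝ → ℝ → ℝ := fun ρ s => radialSlope n e r0 (s ^ n - ρ ^ n) s with hB
  have hAc : Continuous (Function.uncurry A) :=
    continuous_radialSlope hn he0.le hr0 (by fun_prop) (by fun_prop)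
  have hBc : Continuous (Function.uncurry B) :=
    continuous_radialSlope hn he0.le hr0 (by fun_prop) (by fun_prop)
  have hAc' : ∀ ρ, Continuous (A ρ) := fun ρ => hAc.comp (by fun_prop : Continuous fun s => (ρ, s))
  have hBc' : ∀ ρ, Continuous (B ρ) := fun ρ => hBc.comp (by fun_prop : Continuous fun s => (ρ, s))
  have hAz : ∀ ρ s, 0 ≤ ρ → ρ ≤ s → A ρ s = 0 := fun ρ s h0 h =>
    radialSlope_of_nonpos he0.ne' (sub_nonpos.2 (pow_le_pow_left₀ h0 h n)) s
  have hBz : ∀ ρ s, 0 ≤ s → s ≤ ρ → B ρ s = 0 := fun ρ s h0 h =>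
    radialSlope_of_nonpos he0.ne' (sub_nonpos.2 (pow_le_pow_left₀ h0 h n)) s
  have hAp : ∀ ρ s, 0 ≤ s → s < ρ → 0 < A ρ s := fun ρ s h0 h =>
    radialSlope_pos hn hr0 (sub_pos.2 (pow_lt_pow_left₀ h h0 hn)) s
  have hBp : ∀ ρ s, 0 ≤ ρ → ρ < s → 0 < B ρ s := fun ρ s h0 h =>
    radialSlope_pos hn hr0 (sub_pos.2 (pow_lt_pow_left₀ h h0 hn)) s
  set G : ℝ → ℝ := fun ρ => ∫ s in r0..r1, (A ρ s - B ρ s) with hG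
  have hGc : Continuous G :=
    intervalIntegral.continuous_parametric_intervalIntegral_of_continuous' (hAc.sub hBc) r0 r1
  have hGl : G r0 < 0 := by
    have h : 0 < ∫ s in r0..r1, (B r0 s - A r0 s) := by
      refine intervalIntegral.intervalIntegral_pos_of_pos_on
        (((hBc' r0).sub (hAc' r0)).intervalIntegrable _ _) (fun s hs => ?_) hr01
      rw [hAz r0 s hr0.le hs.1.le]
      simpa using hBp r0 s hr0.le hs.1
    have h' : G r0 = -∫ s in r0..r1, (B r0 s - A r0 s) := by
      rw [← intervalIntegral.integral_neg]
      simp [hG]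
    linarith
  have hGr : 0 < G r1 := by
    refine intervalIntegral.intervalIntegral_pos_of_pos_on
      (((hAc' r1).sub (hBc' r1)).intervalIntegrable _ _) (fun s hs => ?_) hr01
    rw [hBz r1 s (hr0.trans hs.1).le hs.2.le]
    simpa using hAp r1 s (hr0.trans hs.1).le hs.2
  obtain ⟨ρ, ⟨hρ0, hρ1⟩, hρ⟩ :=
    intermediate_value_Ioo hr01.le hGc.continuousOn ⟨hGl, hGr⟩
  have hρpos : 0 < ρ := hr0.trans hρ0
  have hiA : ∀ a b, IntervalIntegrable (A ρ) volume a b := fun a b =>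
    (hAc' ρ).intervalIntegrable a b
  have hiB : ∀ a b, IntervalIntegrable (B ρ) volume a b := fun a b =>
    (hBc' ρ).intervalIntegrable a b
  have hAint : ∫ s in ρ..r1, A ρ s = 0 := by
    rw [intervalIntegral.integral_congr (g := fun _ => 0)]
    · simp
    · intro s hs
      rw [uIcc_of_le hρ1.le] at hs
      exact hAz ρ s hρpos.le hs.1
  have hBint : ∫ s in r0..ρ, B ρ s = 0 := by
    rw [intervalIntegral.integral_congr (g := fun _ => 0)]
    · simp
    · intro s hs
      rw [uIcc_of_le hρ0.le] at hs
      exact hBz ρ s (hr0.le.trans hs.1) hs.2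
  refine ⟨ρ, ∫ s in r0..ρ, A ρ s, fun r => ∫ s in r0..r, A ρ s, fun r => -∫ s in r1..r, B ρ s,
    A ρ, B ρ, ?_⟩
  refine
    { lt_rho := hρ0
      rho_lt := hρ1
      continuous_inner := hAc' ρ
      continuous_outer := hBc' ρ
      inner_nonneg := fun s => radialSlope_nonneg hr0 _ _
      outer_nonneg := fun s => radialSlope_nonneg hr0 _ _
      inner_eq_zero := fun s => hAz ρ s hρpos.le
      outer_eq_zero := fun s => hBz ρ s
      inner_pos := fun s => hAp ρ s
      outer_pos := fun s => hBp ρ s hρpos.le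
      hasDerivAt_inner := fun s => intervalIntegral.integral_hasDerivAt_right (hiA _ _)
        ((hAc' ρ).stronglyMeasurableAtFilter _ _) (hAc' ρ).continuousAt
      hasDerivAt_outer := fun s => (intervalIntegral.integral_hasDerivAt_right (hiB _ _)
        ((hBc' ρ).stronglyMeasurableAtFilter _ _) (hBc' ρ).continuousAt).neg
      inner_left := by simp
      outer_right := by simp
      inner_rho := rfl
      outer_rho := ?_
      flux_mul := fun s hs => ?_
      flux_rpow := fun s hs => ?_ }
  · have h : G ρ = (∫ s in r0..r1, A ρ s) - ∫ s in r0..r1, B ρ s :=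
      intervalIntegral.integral_sub (hiA _ _) (hiB _ _)
    have h1 := intervalIntegral.integral_add_adjacent_intervals (hiA r0 ρ) (hiA ρ r1)
    have h2 := intervalIntegral.integral_add_adjacent_intervals (hiB r0 ρ) (hiB ρ r1)
    have h3 := intervalIntegral.integral_symm (μ := volume) (f := B ρ) ρ r1
    linarith
  · rcases le_total s ρ with h | h
    · have ht : 0 ≤ ρ ^ n - s ^ n := sub_nonneg.2 (pow_le_pow_left₀ (hr0.le.trans hs) h n)
      rw [hBz ρ s (hr0.le.trans hs) h, Real.zero_rpow hpq.ne_zero, add_zero, sub_zero]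
      exact (mul_radialSlope hn hpq hr0 ht hs).1
    · have ht : 0 ≤ s ^ n - ρ ^ n := sub_nonneg.2 (pow_le_pow_left₀ hρpos.le h n)
      rw [hAz ρ s hρpos.le h, Real.zero_rpow hpq.ne_zero, zero_add, zero_sub]
      rw [← (mul_radialSlope hn hpq hr0 ht hs).1]
      ring
  · rcases le_total s ρ with h | h
    · have ht : 0 ≤ ρ ^ n - s ^ n := sub_nonneg.2 (pow_le_pow_left₀ (hr0.le.trans hs) h n)
      rw [hBz ρ s (hr0.le.trans hs) h, Real.zero_rpow hpq.ne_zero, add_zero, abs_of_nonneg ht]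
      exact (mul_radialSlope hn hpq hr0 ht hs).2
    · have ht : 0 ≤ s ^ n - ρ ^ n := sub_nonneg.2 (pow_le_pow_left₀ hρpos.le h n)
      rw [hAz ρ s hρpos.le h, Real.zero_rpow hpq.ne_zero, zero_add, abs_sub_comm,
        abs_of_nonneg ht]
      exact (mul_radialSlope hn hpq hr0 ht hs).2

namespace IsRadialProfile

variable {n : ℕ} {p q r0 r1 ρ M : ℝ} {α β α' β' : ℝ → ℝ}

lemma monotone_inner (h : IsRadialProfile n p q r0 r1 ρ M α β α' β') : Monotone α :=
  monotone_of_deriv_nonneg (fun s => (h.hasDerivAt_inner s).differentiableAt) fun s => by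
    rw [(h.hasDerivAt_inner s).deriv]; exact h.inner_nonneg s

lemma antitone_outer (h : IsRadialProfile n p q r0 r1 ρ M α β α' β') : Antitone β :=
  antitone_of_deriv_nonpos (fun s => (h.hasDerivAt_outer s).differentiableAt) fun s => by
    rw [(h.hasDerivAt_outer s).deriv]; exact neg_nonpos.2 (h.outer_nonneg s)

lemma contDiff_inner (h : IsRadialProfile n p q r0 r1 ρ M α β α' β') : ContDiff ℝ 1 α := by
  rw [contDiff_one_iff_deriv, show deriv α = α' from funext fun t => (h.hasDerivAt_inner t).deriv]
  exact ⟨fun t => (h.hasDerivAt_inner t).differentiableAt, h.continuous_inner⟩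

lemma contDiff_outer (h : IsRadialProfile n p q r0 r1 ρ M α β α' β') : ContDiff ℝ 1 β := by
  rw [contDiff_one_iff_deriv,
    show deriv β = fun t => -β' t from funext fun t => (h.hasDerivAt_outer t).deriv]
  exact ⟨fun t => (h.hasDerivAt_outer t).differentiableAt, h.continuous_outer.neg⟩

lemma inner_eq (h : IsRadialProfile n p q r0 r1 ρ M α β α' β') {s : ℝ} (hs : ρ ≤ s) :
    α s = M := by
  have := constant_of_has_deriv_right_zero (f := α) (a := ρ) (b := s)
    h.contDiff_inner.continuous.continuousOn
    (fun x hx => by simpa [h.inner_eq_zero x hx.1] using (h.hasDerivAt_inner x).hasDerivWithinAt)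
  rw [this s ⟨hs, le_rfl⟩, h.inner_rho]

lemma outer_eq (h : IsRadialProfile n p q r0 r1 ρ M α β α' β') {s : ℝ} (hs0 : 0 ≤ s)
    (hs : s ≤ ρ) : β s = M := by
  have := constant_of_has_deriv_right_zero (f := β) (a := s) (b := ρ)
    h.contDiff_outer.continuous.continuousOn
    (fun x hx => by simpa [h.outer_eq_zero x (hs0.trans hx.1) hx.2.le] using
      (h.hasDerivAt_outer x).hasDerivWithinAt)
  rw [← this ρ ⟨hs, le_rfl⟩, h.outer_rho]

lemma inner_le (h : IsRadialProfile n p q r0 r1 ρ M α β α' β') (s : ℝ) : α s ≤ M := by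
  rw [← h.inner_eq (le_max_right s ρ)]
  exact h.monotone_inner (le_max_left _ _)

lemma outer_le (h : IsRadialProfile n p q r0 r1 ρ M α β α' β') {s : ℝ} (hs : 0 ≤ s) :
    β s ≤ M := by
  rcases le_total s ρ with h1 | h1
  · exact (h.outer_eq hs h1).le
  · rw [← h.outer_rho]
    exact h.antitone_outer h1

lemma inner_lt (h : IsRadialProfile n p q r0 r1 ρ M α β α' β') {s : ℝ} (hs0 : 0 ≤ s)
    (hs : s < ρ) : α s < M := by
  rw [← h.inner_rho]
  refine strictMonoOn_of_deriv_pos (convex_Icc s ρ) h.contDiff_inner.continuous.continuousOn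
    (fun x hx => ?_) ⟨le_rfl, hs.le⟩ ⟨hs.le, le_rfl⟩ hs
  rw [interior_Icc] at hx
  rw [(h.hasDerivAt_inner x).deriv]
  exact h.inner_pos x (hs0.trans hx.1.le) hx.2

lemma outer_lt (h : IsRadialProfile n p q r0 r1 ρ M α β α' β') {s : ℝ} (hs : ρ < s) :
    β s < M := by
  rw [← h.outer_rho]
  refine strictAntiOn_of_deriv_neg (convex_Icc ρ s) h.contDiff_outer.continuous.continuousOn
    (fun x hx => ?_) ⟨le_rfl, hs.le⟩ ⟨hs.le, le_rfl⟩ hs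
  rw [interior_Icc] at hx
  rw [(h.hasDerivAt_outer x).deriv]
  exact neg_neg_of_pos (h.outer_pos x hx.1)

lemma lt_of_inner_pos (h : IsRadialProfile n p q r0 r1 ρ M α β α' β') {s : ℝ} (hs : 0 < α s) :
    r0 < s := by
  by_contra! hle
  exact (hs.trans_le ((h.monotone_inner hle).trans_eq h.inner_left)).false

lemma lt_of_outer_pos (h : IsRadialProfile n p q r0 r1 ρ M α β α' β') {s : ℝ} (hs : 0 < β s) :
    s < r1 := by
  by_contra! hle
  exact (hs.trans_le ((h.antitone_outer hle).trans_eq h.outer_right)).false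

/-- The torsion function has integral equal to its Dirichlet energy, in radial coordinates. -/
lemma integral_pow_mul_eq (h : IsRadialProfile n p q r0 r1 ρ M α β α' β') (hn : n ≠ 0)
    (hr0 : 0 ≤ r0) :
    ∫ s in r0..r1, s ^ (n - 1) * (α s + β s - M) =
      ∫ s in r0..r1, s ^ (n - 1) * (α' s ^ p + β' s ^ p) := by
  have hr : r0 ≤ r1 := (h.lt_rho.trans h.rho_lt).le
  have hq : ∀ s, HasDerivAt (fun s : ℝ => (ρ ^ n - s ^ n) / n) (-s ^ (n - 1)) s := by
    intro s
    have := ((hasDerivAt_pow n s).const_sub (ρ ^ n)).div_const (n : ℝ)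
    rwa [neg_div, mul_div_cancel_left₀ _ (Nat.cast_ne_zero.2 hn)] at this
  have hy : ∀ s, HasDerivAt (fun s => α s + β s - M) (α' s - β' s) s := fun s => by
    simpa [sub_eq_add_neg] using ((h.hasDerivAt_inner s).add (h.hasDerivAt_outer s)).sub_const M
  have hibp := intervalIntegral.integral_mul_deriv_eq_deriv_mul (a := r0) (b := r1)
    (fun s _ => hq s) (fun s _ => hy s)
    (Continuous.intervalIntegrable (by fun_prop) _ _)
    ((h.continuous_inner.sub h.continuous_outer).intervalIntegrable _ _)
  have hl : α r0 + β r0 - M = 0 := by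
    rw [h.inner_left, h.outer_eq hr0 h.lt_rho.le]; ring
  have hright : α r1 + β r1 - M = 0 := by
    rw [h.outer_right, h.inner_eq h.rho_lt.le]; ring
  have hflux : ∫ s in r0..r1, (ρ ^ n - s ^ n) / n * (α' s - β' s) =
      ∫ s in r0..r1, s ^ (n - 1) * (α' s ^ p + β' s ^ p) :=
    intervalIntegral.integral_congr fun s hs => by
      rw [uIcc_of_le hr] at hs
      exact h.flux_mul s hs.1
  rw [← hflux, hibp, hl, hright, ← sub_eq_zero]
  simp

end IsRadialProfile

lemma setIntegral_annulus_norm {E : Type*} [NormedAddCommGroup E] [InnerProductSpace ℝ E]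
    [FiniteDimensional ℝ E] [Nontrivial E] [MeasurableSpace E] [BorelSpace E] {r0 r1 : ℝ}
    (hr0 : 0 ≤ r0) (hr : r0 ≤ r1) (G : ℝ → ℝ) :
    ∫ x in ball (0 : E) r1 \ closedBall 0 r0, G ‖x‖ =
      Module.finrank ℝ E * volume.real (ball (0 : E) 1) *
        ∫ s in r0..r1, s ^ (Module.finrank ℝ E - 1) * G s := by
  have hset : ball (0 : E) r1 \ closedBall 0 r0 = {x | ‖x‖ ∈ Ioo r0 r1} := by
    ext x; simp [and_comm]
  have h1 : ∫ x in ball (0 : E) r1 \ closedBall 0 r0, G ‖x‖ =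
      ∫ x : E, (Ioo r0 r1).indicator G ‖x‖ := by
    rw [← integral_indicator (measurableSet_ball.diff measurableSet_closedBall), hset]
    rfl
  have h2 : ∀ y : ℝ, y ^ (Module.finrank ℝ E - 1) * (Ioo r0 r1).indicator G y =
      (Ioo r0 r1).indicator (fun s => s ^ (Module.finrank ℝ E - 1) * G s) y := by
    intro y
    by_cases hy : y ∈ Ioo r0 r1 <;> simp [hy]
  rw [h1, integral_fun_norm_addHaar volume]
  simp only [smul_eq_mul, nsmul_eq_mul, h2]
  rw [setIntegral_indicator measurableSet_Ioo,
    inter_eq_right.2 (show Ioo r0 r1 ⊆ Ioi 0 from fun y hy => hr0.trans_lt hy.1),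
    intervalIntegral.integral_of_le hr, integral_Ioc_eq_integral_Ioo, mul_assoc]


lemma norm_fderiv_comp_norm_sub_le {E : Type*} [NormedAddCommGroup E] [InnerProductSpace ℝ E]
    {a : ℝ → ℝ} {a' : ℝ} {c x : E} (ha : HasDerivAt a a' ‖x - c‖) (hx : x ≠ c) :
    ‖fderiv ℝ (fun y => a ‖y - c‖) x‖ ≤ |a'| := by
  have hn : DifferentiableAt ℝ (fun y : E => ‖y - c‖) x :=
    (differentiableAt_id.sub_const c).norm ℝ (sub_ne_zero.2 hx)
  have h1 : ‖fderiv ℝ (fun y : E => ‖y - c‖) x‖ ≤ 1 := by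
    refine norm_fderiv_le_of_lipschitz ℝ (C := 1) (LipschitzWith.of_dist_le_mul fun y z => ?_)
    simpa [dist_eq_norm] using abs_norm_sub_norm_le (y - c) (z - c)
  have h := ha.comp_hasFDerivAt x hn.hasFDerivAt
  have h' : fderiv ℝ (fun y => a ‖y - c‖) x = a' • fderiv ℝ (fun y : E => ‖y - c‖) x := h.fderiv
  rw [h', norm_smul, Real.norm_eq_abs]
  exact mul_le_of_le_one_right (abs_nonneg _) h1

lemma Continuous.integrableOn_of_subset_closedBall {E : Type*} [NormedAddCommGroup E]
    [InnerProductSpace ℝ E] [FiniteDimensional ℝ E] [MeasurableSpace E] [BorelSpace E]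
    {F : E → ℝ} (hF : Continuous F) {U : Set E} {c : E} {r : ℝ} (hU : U ⊆ closedBall c r) :
    IntegrableOn F U :=
  (hF.continuousOn.integrableOn_compact (isCompact_closedBall c r)).mono_set hU

variable {E : Type*} [NormedAddCommGroup E] [InnerProductSpace ℝ E] [FiniteDimensional ℝ E]
  [Nontrivial E] [MeasurableSpace E] [BorelSpace E]

namespace IsRadialProfile

variable {p q r0 r1 ρ M : ℝ} {α β α' β' : ℝ → ℝ}

lemma continuous_inner_rpow {n : ℕ} (h : IsRadialProfile n p q r0 r1 ρ M α β α' β')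
    (hp : 0 < p) : Continuous fun s => α' s ^ p :=
  h.continuous_inner.rpow_const fun _ => Or.inr hp.le

lemma continuous_outer_rpow {n : ℕ} (h : IsRadialProfile n p q r0 r1 ρ M α β α' β')
    (hp : 0 < p) : Continuous fun s => β' s ^ p :=
  h.continuous_outer.rpow_const fun _ => Or.inr hp.le

/-- The energy of the radial torsion function bounds the torsion energy on the concentric
annulus from above. -/
lemma energy_le (h : IsRadialProfile (Module.finrank ℝ E) p q r0 r1 ρ M α β α' β')
    (hpq : p.HolderConjugate q) (hr0 : 0 < r0) {φ : E → ℝ} (hφ : ContDiff ℝ 1 φ)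
    (hc : HasCompactSupport φ) (hφU : tsupport φ ⊆ ball 0 r1 \ closedBall 0 r0) :
    (∫ x in ball (0 : E) r1 \ closedBall 0 r0, φ x) -
        (1 / p) * ∫ x in ball (0 : E) r1 \ closedBall 0 r0, ‖fderiv ℝ φ x‖ ^ p ≤
      (1 / q) * ∫ x in ball (0 : E) r1 \ closedBall 0 r0, (α' ‖x‖ ^ p + β' ‖x‖ ^ p) := by
  set n := Module.finrank ℝ E with hn
  have hn0 : (n : ℝ) ≠ 0 := Nat.cast_ne_zero.2 Module.finrank_pos.ne'
  set A : Set E := ball (0 : E) r1 \ closedBall 0 r0 with hA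
  have hAm : MeasurableSet A := measurableSet_ball.diff measurableSet_closedBall
  have hAr : ∀ x ∈ A, r0 < ‖x‖ := fun x hx => by simpa [hA] using hx.2
  have hflux : ∀ x ∈ A, (|ρ ^ n - ‖x‖ ^ n| / (n * ‖x‖ ^ (n - 1))) ^ q =
      α' ‖x‖ ^ p + β' ‖x‖ ^ p := fun x hx => h.flux_rpow _ (hAr x hx).le
  rw [← setIntegral_congr_fun hAm hflux]
  set κ : ℝ → ℝ := fun s => (ρ ^ n / s ^ n - 1) / n with hκ
  have hκd : ∀ s, 0 < s → HasDerivAt κ (-(ρ ^ n / (s ^ n * s))) s := by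
    intro s hs
    have h1 := (((hasDerivAt_pow n s).inv (by positivity)).const_mul (ρ ^ n)).sub_const 1
      |>.div_const (n : ℝ)
    have h2 : s ^ n = s ^ (n - 1) * s := by
      rw [← pow_succ, Nat.sub_add_cancel Module.finrank_pos]
    refine (h1.congr_deriv ?_).congr_of_eventuallyEq (Filter.Eventually.of_forall fun t => ?_)
    · rw [h2]; field_simp
    · simp [hκ, div_eq_mul_inv]
  refine integral_sub_le_of_divergence_eq (k := fun x => κ ‖x‖)
    (H := fun x => |ρ ^ n - ‖x‖ ^ n| / (n * ‖x‖ ^ (n - 1))) hAm hpq hφ hc hφU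
    (fun x hx => ?_) (fun x hx => ?_) (fun x hx => ?_) ?_
  · have hx0 : 0 < ‖x‖ := hr0.trans (hAr x hx)
    refine ((contDiffAt_const.div ?_ ?_).sub contDiffAt_const).div_const _
    · exact (contDiffAt_norm ℝ (norm_pos_iff.1 hx0)).pow n
    · positivity
  · have hx0 : 0 < ‖x‖ := hr0.trans (hAr x hx)
    have hd : DifferentiableAt ℝ (fun y : E => ‖y‖) x :=
      differentiableAt_id.norm ℝ (norm_pos_iff.1 hx0)
    have hk : fderiv ℝ (fun y : E => κ ‖y‖) x =
        (-(ρ ^ n / (‖x‖ ^ n * ‖x‖))) • fderiv ℝ (fun y : E => ‖y‖) x :=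
      ((hκd _ hx0).comp_hasFDerivAt x hd.hasFDerivAt).fderiv
    rw [hk, smul_apply, hd.fderiv_norm_self, ← hn]
    simp only [hκ, smul_eq_mul]
    field_simp
    ring
  · have hx0 : 0 < ‖x‖ := hr0.trans (hAr x hx)
    have h2 : ‖x‖ ^ n = ‖x‖ ^ (n - 1) * ‖x‖ := by
      rw [← pow_succ, Nat.sub_add_cancel Module.finrank_pos]
    have h3 : κ ‖x‖ = (ρ ^ n - ‖x‖ ^ n) / (n * ‖x‖ ^ n) := by
      simp only [hκ]; field_simp
    rw [h3, abs_div, abs_of_nonneg (by positivity : (0 : ℝ) ≤ n * ‖x‖ ^ n)]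
    refine le_of_eq ?_
    rw [div_mul_eq_mul_div, h2]
    field_simp
  · refine IntegrableOn.congr_fun (f := fun x => α' ‖x‖ ^ p + β' ‖x‖ ^ p) ?_
      (fun x hx => (hflux x hx).symm) hAm
    refine Continuous.integrableOn_of_subset_closedBall (c := 0) (r := r1) ?_
      (sdiff_subset.trans ball_subset_closedBall)
    exact ((h.continuous_inner_rpow hpq.pos).comp continuous_norm).add
      ((h.continuous_outer_rpow hpq.pos).comp continuous_norm)

/-- Translating the inner part of the radial torsion function, and gluing with the outer part by
taking the minimum, strictly increases the torsion energy. -/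
lemma energy_lt (h : IsRadialProfile (Module.finrank ℝ E) p q r0 r1 ρ M α β α' β')
    (hpq : p.HolderConjugate q) (hr0 : 0 < r0) {c : E} (hc0 : 0 < ‖c‖) (hc1 : ‖c‖ < r1 - r0)
    {S : ℝ} (hS : ∀ v : E → ℝ, ContDiff ℝ 1 v → HasCompactSupport v →
      tsupport v ⊆ ball 0 r1 \ closedBall c r0 →
      (∫ x in ball 0 r1 \ closedBall c r0, v x) -
        (1 / p) * ∫ x in ball 0 r1 \ closedBall c r0, ‖fderiv ℝ v x‖ ^ p ≤ S) :
    (1 / q) * ∫ x in ball (0 : E) r1 \ closedBall 0 r0, (α' ‖x‖ ^ p + β' ‖x‖ ^ p) < S := by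
  have hp : 0 < p := hpq.pos
  have hρ0 : 0 < ρ := hr0.trans h.lt_rho
  set A : Set E := ball (0 : E) r1 \ closedBall 0 r0 with hA
  set Ω : Set E := ball (0 : E) r1 \ closedBall c r0 with hΩ
  have hAm : MeasurableSet A := measurableSet_ball.diff measurableSet_closedBall
  have hΩo : IsOpen Ω := isOpen_ball.sdiff isClosed_closedBall
  have hAb : A ⊆ closedBall 0 r1 := sdiff_subset.trans ball_subset_closedBall
  have hΩb : Ω ⊆ closedBall 0 r1 := sdiff_subset.trans ball_subset_closedBall
  have hΩf : volume Ω ≠ ⊤ := (isBounded_closedBall.subset hΩb).measure_lt_top.ne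
  have hα : Continuous α := h.contDiff_inner.continuous
  have hβ : Continuous β := h.contDiff_outer.continuous
  have hα' := h.continuous_inner_rpow hp
  have hβ' := h.continuous_outer_rpow hp
  have hnc : Continuous fun x : E => ‖x - c‖ := by fun_prop
  set Λ : ℝ → ℝ := fun s => M - α s + (1 / p) * α' s ^ p with hΛ
  set Γ : ℝ → ℝ := fun s => M - β s + (1 / p) * β' s ^ p with hΓ
  have hΛc : Continuous Λ := (continuous_const.sub hα).add (continuous_const.mul hα')
  have hΓc : Continuous Γ := (continuous_const.sub hβ).add (continuous_const.mul hβ')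
  have hΛ0 : ∀ s, 0 ≤ Λ s := fun s => by
    have := Real.rpow_nonneg (h.inner_nonneg s) p
    have := sub_nonneg.2 (h.inner_le s)
    simp only [hΛ]; positivity
  have hΓ0 : ∀ s, 0 ≤ s → 0 ≤ Γ s := fun s hs => by
    have := Real.rpow_nonneg (h.outer_nonneg s) p
    have := sub_nonneg.2 (h.outer_le hs)
    simp only [hΓ]; positivity
  have hΛz : ∀ s, ρ ≤ s → Λ s = 0 := fun s hs => by
    simp [hΛ, h.inner_eq hs, h.inner_eq_zero s hs, hp.ne']
  have hΓz : ∀ s, 0 ≤ s → s ≤ ρ → Γ s = 0 := fun s hs0 hs => by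
    simp [hΓ, h.outer_eq hs0 hs, h.outer_eq_zero s hs0 hs, hp.ne']
  -- the energy of the glued function
  have hmin := integral_min_sub_le_of_forall_energy_le hΩf hp hS
    (f := fun x => α ‖x - c‖) (g := fun x => β ‖x‖) (A := fun x => α' ‖x - c‖)
    (B := fun x => β' ‖x‖) (fun x hfx hgx => by
      have hx : x ≠ c := by
        rintro rfl
        have := h.lt_of_inner_pos hfx
        simp only [sub_self, norm_zero] at this
        linarith
      refine ⟨h.contDiff_inner.contDiffAt.comp x
        ((contDiffAt_norm ℝ (sub_ne_zero.2 hx)).comp x (contDiffAt_id.sub contDiffAt_const)),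
        ?_, ?_, ?_⟩
      · rcases eq_or_ne x 0 with rfl | hx0
        · refine (contDiffAt_const (c := M)).congr_of_eventuallyEq ?_
          filter_upwards [ball_mem_nhds (0 : E) hρ0] with y hy
          exact h.outer_eq (norm_nonneg y) (mem_ball_zero_iff.1 hy).le
        · exact h.contDiff_outer.contDiffAt.comp x (contDiffAt_norm ℝ hx0)
      · simpa [abs_of_nonneg (h.inner_nonneg _)] using
          norm_fderiv_comp_norm_sub_le (h.hasDerivAt_inner ‖x - c‖) hx
      · rcases eq_or_ne x 0 with rfl | hx0
        · have : (fun y : E => β ‖y‖) =ᶠ[nhds 0] fun _ => M := by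
            filter_upwards [ball_mem_nhds (0 : E) hρ0] with y hy
            exact h.outer_eq (norm_nonneg y) (mem_ball_zero_iff.1 hy).le
          rw [this.fderiv_eq]
          simpa using h.outer_nonneg 0
        · have := norm_fderiv_comp_norm_sub_le (c := 0) (h.hasDerivAt_outer ‖x - 0‖) hx0
          simpa [abs_of_nonneg (h.outer_nonneg _)] using this)
    (fun ε hε => by
      refine (isCompact_closedBall (0 : E) r1).of_isClosed_subset ?_ ?_
      · exact (isClosed_le continuous_const (hα.comp hnc)).inter
          (isClosed_le continuous_const (hβ.comp continuous_norm))
      · intro x hx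
        simpa using (h.lt_of_outer_pos (hε.trans_le hx.2)).le)
    (fun x hfx hgx => by
      have h1 := h.lt_of_inner_pos hfx
      have h2 := h.lt_of_outer_pos hgx
      simpa [hΩ, dist_eq_norm] using And.intro h2 h1)
    (fun x => h.inner_nonneg _) (fun x => h.outer_nonneg _)
    (((hα.comp hnc).min (hβ.comp continuous_norm)).integrableOn_of_subset_closedBall hΩb)
    ((hα'.comp hnc).integrableOn_of_subset_closedBall hΩb)
    ((hβ'.comp continuous_norm).integrableOn_of_subset_closedBall hΩb)
  -- the gain on the overlap
  set gain : E → ℝ := fun x => M - max (α ‖x - c‖) (β ‖x‖) with hgain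
  have hgc : Continuous gain :=
    continuous_const.sub ((hα.comp hnc).max (hβ.comp continuous_norm))
  have hgi : IntegrableOn gain Ω := hgc.integrableOn_of_subset_closedBall hΩb
  have hg0 : ∀ x, 0 ≤ gain x := fun x =>
    sub_nonneg.2 (max_le (h.inner_le _) (h.outer_le (norm_nonneg _)))
  have hgpos : 0 < ∫ x in Ω, gain x := by
    obtain ⟨t, ht1, ht2⟩ := exists_between (show max ρ (‖c‖ + r0) < min r1 (ρ + ‖c‖) from
      max_lt (lt_min h.rho_lt (by linarith)) (lt_min (by linarith) (by linarith [h.lt_rho])))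
    obtain ⟨ht1, ht1'⟩ := max_lt_iff.1 ht1
    obtain ⟨ht2, ht2'⟩ := lt_min_iff.1 ht2
    set x : E := (t / ‖c‖) • c with hx
    have ht0 : 0 < t := hρ0.trans ht1
    have hxn : ‖x‖ = t := by
      rw [hx, norm_smul, Real.norm_of_nonneg (by positivity)]
      field_simp
    have hxc : ‖x - c‖ = t - ‖c‖ := by
      have : x - c = ((t - ‖c‖) / ‖c‖) • c := by
        rw [sub_div, div_self hc0.ne', sub_smul, one_smul]
      rw [this, norm_smul, Real.norm_of_nonneg (div_nonneg (by linarith) hc0.le)]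
      field_simp
    have hxΩ : x ∈ Ω := by
      refine ⟨by simpa [hxn] using ht2, ?_⟩
      rw [mem_closedBall, dist_eq_norm, hxc]
      linarith
    have hxg : 0 < gain x := by
      refine sub_pos.2 (max_lt (h.inner_lt (norm_nonneg _) ?_) (h.outer_lt ?_))
      · rw [hxc]; linarith
      · rwa [hxn]
    rw [setIntegral_pos_iff_support_of_nonneg_ae
      (Filter.Eventually.of_forall hg0) hgi]
    have hso : IsOpen (Function.support gain ∩ Ω) :=
      (isOpen_ne_fun hgc continuous_const).inter hΩo
    exact hso.measure_pos volume ⟨x, hxg.ne', hxΩ⟩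
  -- comparison of the two pieces with the concentric ones
  have hΛi : IntegrableOn (fun x : E => Λ ‖x‖) A :=
    (hΛc.comp continuous_norm).integrableOn_of_subset_closedBall hAb
  have hΓi : IntegrableOn (fun x : E => Γ ‖x‖) A :=
    (hΓc.comp continuous_norm).integrableOn_of_subset_closedBall hAb
  have hΛiΩ : IntegrableOn (fun x : E => Λ ‖x - c‖) Ω :=
    (hΛc.comp hnc).integrableOn_of_subset_closedBall hΩb
  have hΓiΩ : IntegrableOn (fun x : E => Γ ‖x‖) Ω :=
    (hΓc.comp continuous_norm).integrableOn_of_subset_closedBall hΩb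
  have hin : ∫ x in Ω, Λ ‖x - c‖ ≤ ∫ x in A, Λ ‖x‖ := by
    set F : E → ℝ := A.indicator fun x => Λ ‖x‖ with hF
    have hFi : Integrable F := hΛi.integrable_indicator hAm
    have hF0 : ∀ x, 0 ≤ F x := fun x => indicator_nonneg (fun y _ => hΛ0 _) x
    have hFΩ : ∀ x ∈ Ω, Λ ‖x - c‖ = F (x - c) := by
      intro x hx
      by_cases hxA : x - c ∈ A
      · rw [hF, indicator_of_mem hxA]
      · rw [hF, indicator_of_notMem hxA]
        refine hΛz _ ?_
        by_contra! hlt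
        refine hxA ⟨?_, ?_⟩
        · simpa using hlt.trans h.rho_lt
        · simpa [dist_eq_norm] using hx.2
    calc ∫ x in Ω, Λ ‖x - c‖ = ∫ x in Ω, F (x - c) := setIntegral_congr_fun hΩo.measurableSet hFΩ
      _ ≤ ∫ x, F (x - c) := setIntegral_le_integral (hFi.comp_sub_right c)
          (Filter.Eventually.of_forall fun x => hF0 _)
      _ = ∫ x, F x := integral_sub_right_eq_self F c
      _ = ∫ x in A, Λ ‖x‖ := integral_indicator hAm
  have hout : ∫ x in Ω, Γ ‖x‖ ≤ ∫ x in A, Γ ‖x‖ := by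
    have h1 : ∫ x in ball (0 : E) r1, Γ ‖x‖ = ∫ x in A, Γ ‖x‖ := by
      refine setIntegral_eq_of_subset_of_forall_sdiff_eq_zero measurableSet_ball sdiff_subset ?_
      rintro x ⟨hx1, hx2⟩
      refine hΓz _ (norm_nonneg _) ?_
      by_contra! hlt
      exact hx2 ⟨hx1, by simpa using h.lt_rho.trans hlt⟩
    rw [← h1]
    exact setIntegral_mono_set
      ((hΓc.comp continuous_norm).integrableOn_of_subset_closedBall ball_subset_closedBall)
      (Filter.Eventually.of_forall fun x => hΓ0 _ (norm_nonneg _))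
      sdiff_subset.eventuallyLE
  have hvol : volume.real Ω = volume.real A := by
    rw [hΩ, hA, measureReal_sdiff, measureReal_sdiff]
    · simp only [Measure.real, Measure.addHaar_closedBall_center]
    · exact closedBall_subset_ball (by linarith [h.lt_rho, h.rho_lt])
    · exact measurableSet_closedBall
    · intro x hx
      rw [mem_closedBall, dist_eq_norm] at hx
      rw [mem_ball_zero_iff]
      linarith [norm_le_norm_add_norm_sub' x c]
    · exact measurableSet_closedBall
  -- the energy of the concentric solution
  have hpolar : ∫ x in A, (α ‖x‖ + β ‖x‖ - M) = ∫ x in A, (α' ‖x‖ ^ p + β' ‖x‖ ^ p) := by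
    have hr := (h.lt_rho.trans h.rho_lt).le
    rw [hA, setIntegral_annulus_norm hr0.le hr (fun s => α s + β s - M),
      setIntegral_annulus_norm hr0.le hr (fun s => α' s ^ p + β' s ^ p),
      h.integral_pow_mul_eq Module.finrank_pos.ne' hr0.le]
  have hSi : IntegrableOn (fun x : E => α' ‖x‖ ^ p + β' ‖x‖ ^ p) A :=
    ((hα'.add hβ').comp continuous_norm).integrableOn_of_subset_closedBall hAb
  have hMA : IntegrableOn (fun _ : E => M) A :=
    continuous_const.integrableOn_of_subset_closedBall hAb
  have hMΩ : IntegrableOn (fun _ : E => M) Ω :=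
    continuous_const.integrableOn_of_subset_closedBall hΩb
  have hMΛ : IntegrableOn (fun x : E => M - Λ ‖x‖) A := hMA.sub hΛi
  have hMΛΓ : IntegrableOn (fun x : E => M - Λ ‖x‖ - Γ ‖x‖) A := hMΛ.sub hΓi
  have hMΛΩ : IntegrableOn (fun x : E => M - Λ ‖x - c‖) Ω := hMΩ.sub hΛiΩ
  have hMΛΓΩ : IntegrableOn (fun x : E => M - Λ ‖x - c‖ - Γ ‖x‖) Ω := hMΛΩ.sub hΓiΩ
  have hconc : ∫ x in A, (α ‖x‖ + β ‖x‖ - M) =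
      ((volume.real A * M - ∫ x in A, Λ ‖x‖) - ∫ x in A, Γ ‖x‖) +
        (1 / p) * ∫ x in A, (α' ‖x‖ ^ p + β' ‖x‖ ^ p) := by
    rw [← smul_eq_mul (volume.real A), ← setIntegral_const, ← integral_sub hMA hΛi,
      ← integral_sub hMΛ hΓi, ← integral_const_mul,
      ← integral_add hMΛΓ (hSi.const_mul _)]
    refine integral_congr_ae (Filter.Eventually.of_forall fun x => ?_)
    simp only [hΛ, hΓ]
    ring
  have hecc : (∫ x in Ω, min (α ‖x - c‖) (β ‖x‖)) -
      (1 / p) * ∫ x in Ω, (α' ‖x - c‖ ^ p + β' ‖x‖ ^ p) =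
      ((volume.real Ω * M - ∫ x in Ω, Λ ‖x - c‖) - ∫ x in Ω, Γ ‖x‖) + ∫ x in Ω, gain x := by
    rw [← smul_eq_mul (volume.real Ω), ← setIntegral_const, ← integral_sub hMΩ hΛiΩ,
      ← integral_sub hMΛΩ hΓiΩ, ← integral_add hMΛΓΩ hgi,
      ← integral_const_mul, ← integral_sub]
    · refine integral_congr_ae (Filter.Eventually.of_forall fun x => ?_)
      simp only [hΛ, hΓ, hgain]
      linear_combination min_add_max (α ‖x - c‖) (β ‖x‖)
    · exact ((hα.comp hnc).min (hβ.comp continuous_norm)).integrableOn_of_subset_closedBall hΩb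
    · exact (continuous_const.mul ((hα'.comp hnc).add
        (hβ'.comp continuous_norm))).integrableOn_of_subset_closedBall hΩb
  have hqp : 1 / q = 1 - 1 / p := by
    have := hpq.inv_add_inv_eq_one
    simp only [one_div]; linarith
  rw [hecc, hvol] at hmin
  rw [hqp]
  linarith

end IsRadialProfile

end Radial

/-- The torsion energy is bounded above on bounded sets. -/
lemma exists_forall_energy_le {E : Type*} [NormedAddCommGroup E] [InnerProductSpace ℝ E]
    [FiniteDimensional ℝ E] [Nontrivial E] [MeasurableSpace E] [BorelSpace E] {U : Set E}
    (hU : MeasurableSet U) {r : ℝ} (hUr : U ⊆ closedBall 0 r) {p q : ℝ}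
    (hpq : p.HolderConjugate q) :
    ∃ C, ∀ φ : E → ℝ, ContDiff ℝ 1 φ → HasCompactSupport φ → tsupport φ ⊆ U →
      (∫ x in U, φ x) - (1 / p) * ∫ x in U, ‖fderiv ℝ φ x‖ ^ p ≤ C := by
  have hn : 0 < (Module.finrank ℝ E : ℝ) := Nat.cast_pos.2 Module.finrank_pos
  refine ⟨_, fun φ hφ hc hφU => integral_sub_le_of_divergence_eq
    (k := fun _ => -1 / (Module.finrank ℝ E : ℝ)) (H := fun x => 1 / Module.finrank ℝ E * ‖x‖)
    hU hpq hφ hc hφU (fun x _ => contDiffAt_const) (fun x _ => ?_) (fun x _ => ?_) ?_⟩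
  · simp only [fderiv_fun_const, Pi.zero_apply, zero_apply, add_zero]
    field_simp
  · rw [abs_div, abs_neg, abs_one, abs_of_pos hn]
  · exact (Continuous.rpow_const (by fun_prop) fun _ =>
      Or.inr hpq.symm.pos.le).integrableOn_of_subset_closedBall hUr

/-- Among all placements of a ball of radius `r0` inside `B(0,r1)`, the `p`-torsional
rigidity of the complement is strictly minimal exactly in the concentric configuration. -/
theorem torsionalRigidity_lt_of_not_concentric
    (N : ℕ) (hN : 2 ≤ N) (p : ℝ) (hp : 1 < p) (r0 r1 : ℝ)
    (hr0 : 0 < r0) (hr01 : r0 < r1) (c : EuclideanSpace ℝ (Fin N))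
    (hc0 : 0 < ‖c‖) (hc1 : ‖c‖ < r1 - r0) :
    pTorsionalRigidity p
        (Metric.ball (0 : EuclideanSpace ℝ (Fin N)) r1 \ closure (Metric.ball 0 r0)) <
      pTorsionalRigidity p
        (Metric.ball (0 : EuclideanSpace ℝ (Fin N)) r1 \ closure (Metric.ball c r0)) := by
  have : Nonempty (Fin N) := ⟨⟨0, by omega⟩⟩
  obtain ⟨q, hpq⟩ : ∃ q, p.HolderConjugate q := ⟨_, Real.HolderConjugate.conjExponent hp⟩
  rw [closure_ball _ hr0.ne', closure_ball _ hr0.ne']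
  have hE : Module.finrank ℝ (EuclideanSpace ℝ (Fin N)) ≠ 0 := Module.finrank_pos.ne'
  obtain ⟨ρ, M, α, β, α', β', h⟩ := exists_isRadialProfile hE hpq hr0 hr01
  simp only [pTorsionalRigidity, norm_gradient_eq_norm_fderiv]
  refine mul_lt_mul_of_pos_left ?_ (div_pos hpq.pos (sub_pos.2 hp))
  refine lt_of_le_of_lt (csSup_le ⟨0, 0, ?_, ?_⟩ ?_)
    (h.energy_lt hpq hr0 hc0 hc1 fun v hv hvc hvU => ?_)
  · exact ⟨contDiff_const, HasCompactSupport.zero, by simp⟩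
  · simp [Real.zero_rpow hpq.ne_zero]
  · rintro r ⟨φ, ⟨hφ, hφc, hφU⟩, rfl⟩
    exact h.energy_le hpq hr0 (hφ.of_le (by simp)) hφc hφU
  · have hb : ball (0 : EuclideanSpace ℝ (Fin N)) r1 \ closedBall c r0 ⊆ closedBall 0 r1 :=
      sdiff_subset.trans ball_subset_closedBall
    have ho : IsOpen (ball (0 : EuclideanSpace ℝ (Fin N)) r1 \ closedBall c r0) :=
      isOpen_ball.sdiff isClosed_closedBall
    obtain ⟨C, hC⟩ := exists_forall_energy_le ho.measurableSet hb hpq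
    obtain ⟨φ, hφ, hφc, hφU, hlim⟩ := exists_contDiff_tendsto_energy ho
      (isBounded_closedBall.subset hb).measure_lt_top.ne hpq.pos hv hvc hvU
    refine le_of_tendsto' hlim fun k => le_csSup ⟨C, ?_⟩ ⟨φ k, ⟨hφ k, hφc k, hφU k⟩, rfl⟩
    rintro r ⟨ψ, ⟨hψ, hψc, hψU⟩, rfl⟩
    exact hC ψ (hψ.of_le (by simp)) hψc hψU

end
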